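/- For every positive integer n: if n is not divisible by 4 then eo̅₀(n) = eo̅₂(n), and if n is divisible by 4 then eo̅₀(n) > eo̅₂(n). -/

import Mathlib

/-- A partition is a finite multiset of positive integers. -/
def IsPartition (m : Multiset ℕ) : Prop := ∀ x ∈ m, 0 < x

/-- The largest even part of a partition (0 if there are no even parts). -/
def lep (m : Multiset ℕ) : ℕ := (m.filter (fun x => Even x)).sup

/-- `EO*`: every even part is smaller than every odd part, every part other than the
largest even part appears an even number of times, and the largest even part appears
an odd number of times. -/
def EOStar (m : Multiset ℕ) : Prop :=
  IsPartition m ∧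
  (∀ x ∈ m, ∀ y ∈ m, Even x → Odd y → x < y) ∧
  (∀ x ∈ m, x ≠ lep m → Even (m.count x)) ∧
  (∀ x ∈ m, x = lep m → Odd (m.count x))

/-- `E*`: partitions into even parts where each distinct part appears an even number of times. -/
def EStar (m : Multiset ℕ) : Prop :=
  IsPartition m ∧ (∀ x ∈ m, Even x) ∧ ∀ x : ℕ, Even (m.count x)

/-- `O_k*`: partitions into odd parts with exactly `2k` parts where each distinct part
appears an even number of times. -/
def OStar (k : ℕ) (m : Multiset ℕ) : Prop :=
  IsPartition m ∧ (∀ x ∈ m, Odd x) ∧ Multiset.card m = 2 * k ∧ ∀ x : ℕ, Even (m.count x)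

/-- `Q_{k,r}`: partitions with a `(k+r+1) × k` Durfee rectangle whose largest part below
the rectangle is `< k+r+1`; equivalently, exactly `k` parts are `≥ k+r+1`. -/
def QSet (k r : ℕ) (m : Multiset ℕ) : Prop :=
  IsPartition m ∧ Multiset.card (m.filter (fun x => k + r + 1 ≤ x)) = k

/-- `EO*_{k,r}`: partitions in `EO*` with exactly `2k` odd parts and largest even part `2k+2r`. -/
def EOkr (k r : ℕ) (m : Multiset ℕ) : Prop :=
  EOStar m ∧ Multiset.card (m.filter (fun x => Odd x)) = 2 * k ∧ lep m = 2 * k + 2 * r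

/-- The even-odd crank: largest even part minus the number of odd parts. -/
def eoc (m : Multiset ℕ) : ℤ :=
  (lep m : ℤ) - (Multiset.card (m.filter (fun x => Odd x)) : ℤ)

/-- The conjugate partition: its `i`-th part is the number of parts that are `≥ i`. -/
def conjugate (m : Multiset ℕ) : Multiset ℕ :=
  (Multiset.range m.sup).map (fun i => Multiset.card (m.filter (fun x => i + 1 ≤ x)))

/-- An overpartition: a partition together with a set of overlined part values, which must
be a subset of the distinct part values. -/
def IsOverpartition (p : Multiset ℕ × Finset ℕ) : Prop :=
  IsPartition p.1 ∧ p.2 ⊆ p.1.toFinset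


/-- `EO̅*`: overpartitions in which every even part is below every odd part and only the
largest even part appears an odd number of times (overlined and non-overlined occurrences
counted together). -/
def OverEOStar (p : Multiset ℕ × Finset ℕ) : Prop :=
  IsOverpartition p ∧
  (∀ x ∈ p.1, ∀ y ∈ p.1, Even x → Odd y → x < y) ∧
  (∀ x ∈ p.1, x ≠ lep p.1 → Even (p.1.count x)) ∧
  (∀ x ∈ p.1, x = lep p.1 → Odd (p.1.count x))

namespace OverpartitionEO
open PowerSeries

/-- The `q`-Pochhammer symbol `(a; X²)ₙ` in `ℚ⟦X⟧`. -/
noncomputable def qPoch (a : ℚ⟦X⟧) (n : ℕ) : ℚ⟦X⟧ :=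
  ∏ i ∈ Finset.range n, (1 - a * X ^ (2 * i))

theorem qPoch_zero (a : ℚ⟦X⟧) : qPoch a 0 = 1 := by simp [qPoch]

theorem qPoch_succ (a : ℚ⟦X⟧) (n : ℕ) :
    qPoch a (n + 1) = qPoch a n * (1 - a * X ^ (2 * n)) := Finset.prod_range_succ _ _

theorem qPoch_succ' (a : ℚ⟦X⟧) (n : ℕ) :
    qPoch a (n + 1) = (1 - a) * qPoch (a * X ^ 2) n := by
  rw [qPoch, Finset.prod_range_succ', qPoch, mul_comm]
  congr 1
  · simp
  · exact Finset.prod_congr rfl fun i _ => by ring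

theorem constantCoeff_qPoch {a : ℚ⟦X⟧} (ha : constantCoeff a = 0) (n : ℕ) :
    constantCoeff (qPoch a n) = 1 := by
  simp [qPoch, map_prod, ha]

theorem inv_eq_mul_inv_mul {u v : ℚ⟦X⟧} (hv : constantCoeff v ≠ 0) :
    u⁻¹ = (u * v)⁻¹ * v := by
  rw [PowerSeries.mul_inv_rev, mul_comm, ← mul_assoc, PowerSeries.mul_inv_cancel _ hv, one_mul]

/-- The terms of the `₂φ₁` series with base `X²`, parameters `a, X; aX` and argument `-X`. -/
noncomputable def phiTerm (a : ℚ⟦X⟧) (n : ℕ) : ℚ⟦X⟧ :=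
  (-X) ^ n * qPoch a n * qPoch X n * (qPoch (X ^ 2) n)⁻¹ * (qPoch (a * X) n)⁻¹

/-- Partial sums of the `₂φ₁` series. -/
noncomputable def phiSum (a : ℚ⟦X⟧) (n : ℕ) : ℚ⟦X⟧ := ∑ i ∈ Finset.range n, phiTerm a i

theorem phiSum_contiguous (a : ℚ⟦X⟧) (n : ℕ) :
    (1 - a * X) * (1 - a * X ^ 3) * phiSum a (n + 1)
      - (1 - a * X ^ 2) ^ 2 * phiSum (a * X ^ 4) (n + 1) =
    a * (1 - X) * (-X) ^ (n + 1) * qPoch (a * X ^ 2) n * qPoch X (n + 1) *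
      (qPoch (X ^ 2) n)⁻¹ * (qPoch (a * X) (n + 2))⁻¹ * ((1 - a * X) * (1 - a * X ^ 3)) := by
  induction n with
  | zero =>
    have h : (qPoch (a * X) 2)⁻¹ * ((1 - a * X) * (1 - a * X ^ 3)) = 1 := by
      have : (1 - a * X) * (1 - a * X ^ 3) = qPoch (a * X) 2 := by
        simp only [qPoch_succ, qPoch_zero]; ring
      rw [this, PowerSeries.inv_mul_cancel]
      rw [constantCoeff_qPoch (by simp)]
      exact one_ne_zero
    rw [mul_assoc _ _ ((1 - a * X) * (1 - a * X ^ 3)), zero_add, h]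
    simp [phiSum, phiTerm, qPoch_zero, qPoch_succ]
    ring
  | succ n ih =>
    have hS : ∀ b, phiSum b (n + 1 + 1) = phiSum b (n + 1) + phiTerm b (n + 1) :=
      fun b => Finset.sum_range_succ _ _
    have e1 : (qPoch (X ^ 2) n)⁻¹ = (qPoch (X ^ 2) (n + 1))⁻¹ * (1 - X ^ 2 * X ^ (2 * n)) := by
      rw [qPoch_succ]
      exact inv_eq_mul_inv_mul (by simp)
    have step : ∀ k, (qPoch (a * X) k)⁻¹
        = (qPoch (a * X) (k + 1))⁻¹ * (1 - a * X * X ^ (2 * k)) := by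
      intro k
      rw [qPoch_succ]
      exact inv_eq_mul_inv_mul (by simp)
    have e4 : (qPoch (a * X ^ 4 * X) (n + 1))⁻¹
        = (qPoch (a * X) (n + 3))⁻¹ * ((1 - a * X) * (1 - a * X ^ 3)) := by
      have : qPoch (a * X) (n + 3)
          = qPoch (a * X ^ 4 * X) (n + 1) * ((1 - a * X) * (1 - a * X ^ 3)) := by
        rw [qPoch_succ', qPoch_succ']
        ring_nf
      rw [this]
      exact inv_eq_mul_inv_mul (by simp)
    have e5 : (1 - a * X ^ 2) * qPoch (a * X ^ 4) (n + 1)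
        = qPoch (a * X ^ 2) n * (1 - a * X ^ 2 * X ^ (2 * n))
          * (1 - a * X ^ 2 * X ^ (2 * (n + 1))) := by
      rw [← qPoch_succ, ← qPoch_succ, qPoch_succ' (a * X ^ 2) (n + 1)]
      ring_nf
    have e6 : qPoch a (n + 1) = (1 - a) * qPoch (a * X ^ 2) n := qPoch_succ' _ _
    rw [hS, hS]
    have key : (1 - a * X) * (1 - a * X ^ 3) * phiTerm a (n + 1)
        - (1 - a * X ^ 2) * ((-X) ^ (n + 1) * ((1 - a * X ^ 2) * qPoch (a * X ^ 4) (n + 1)) *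
          qPoch X (n + 1) * (qPoch (X ^ 2) (n + 1))⁻¹ * (qPoch (a * X ^ 4 * X) (n + 1))⁻¹) =
        a * (1 - X) * (-X) ^ (n + 2) * qPoch (a * X ^ 2) (n + 1) * qPoch X (n + 2) *
      (qPoch (X ^ 2) (n + 1))⁻¹ * (qPoch (a * X) (n + 3))⁻¹ * ((1 - a * X) * (1 - a * X ^ 3))
        - a * (1 - X) * (-X) ^ (n + 1) * qPoch (a * X ^ 2) n * qPoch X (n + 1) *
      (qPoch (X ^ 2) n)⁻¹ * (qPoch (a * X) (n + 2))⁻¹ * ((1 - a * X) * (1 - a * X ^ 3)) := by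
      rw [phiTerm, e5, e4, e1, step (n + 1), step (n + 1 + 1), e6, qPoch_succ (a * X ^ 2) n,
        qPoch_succ X (n + 1)]
      simp only [show n + 1 + 1 = n + 2 from rfl, show n + 2 + 1 = n + 3 from rfl]
      generalize (qPoch (a * X) (n + 3))⁻¹ = r
      generalize (qPoch (X ^ 2) (n + 1))⁻¹ = s
      generalize qPoch (a * X ^ 2) n = u
      generalize qPoch X (n + 1) = v
      ring
    have : phiTerm (a * X ^ 4) (n + 1) = (-X) ^ (n + 1) * qPoch (a * X ^ 4) (n + 1) *
          qPoch X (n + 1) * (qPoch (X ^ 2) (n + 1))⁻¹ * (qPoch (a * X ^ 4 * X) (n + 1))⁻¹ := rfl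
    rw [this]
    linear_combination ih + key

theorem qPoch_two_mul (a : ℚ⟦X⟧) (m : ℕ) :
    qPoch (a * X) (2 * m + 2) = qPoch (a * X) (2 * m) *
      ((1 - a * X ^ (4 * m) * X) * (1 - a * X ^ (4 * m) * X ^ 3)) := by
  rw [qPoch_succ, qPoch_succ]
  ring

/-- The product `(aX²; X⁴)ₘ`. -/
noncomputable def oddPoch (a : ℚ⟦X⟧) (m : ℕ) : ℚ⟦X⟧ :=
  ∏ i ∈ Finset.range m, (1 - a * X ^ (4 * i + 2))

variable {A : Type*} [CommRing A]

theorem map_phiSum_iterate (φ : ℚ⟦X⟧ →+* A) {n : ℕ} (hφ : φ (X ^ (n + 1)) = 0)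
    (a : ℚ⟦X⟧) (m : ℕ) :
    φ (qPoch (a * X) (2 * m) * phiSum a (n + 1)) =
      φ (oddPoch a m ^ 2 * phiSum (a * X ^ (4 * m)) (n + 1)) := by
  induction m with
  | zero => simp [qPoch_zero, oddPoch]
  | succ m ih =>
    have h := congrArg φ (phiSum_contiguous (a * X ^ (4 * m)) n)
    rw [show ∀ b c d e f g h : ℚ⟦X⟧, b * c * (-X) ^ (n + 1) * d * e * f * g * h
      = X ^ (n + 1) * ((-1) ^ (n + 1) * b * c * d * e * f * g * h) from
        fun b c d e f g h => by rw [neg_pow]; ring, map_mul, hφ, zero_mul, map_sub, sub_eq_zero,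
      show a * X ^ (4 * m) * X ^ 4 = a * X ^ (4 * (m + 1)) by ring] at h
    rw [show 2 * (m + 1) = 2 * m + 2 by ring, qPoch_two_mul, oddPoch, Finset.prod_range_succ,
      ← oddPoch]
    simp only [map_mul, map_pow] at *
    rw [show a * X ^ (4 * m + 2) = a * X ^ (4 * m) * X ^ 2 by ring]
    generalize φ (phiSum (a * X ^ (4 * (m + 1))) (n + 1)) = s at *
    linear_combination (φ (1 - a * X ^ (4 * m) * X) * φ (1 - a * X ^ (4 * m) * X ^ 3)) * ih +
      φ (oddPoch a m) ^ 2 * h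

theorem map_phiSum_eq_of_map_eq_zero (φ : ℚ⟦X⟧ →+* A) {a : ℚ⟦X⟧} (ha : φ a = 0) (n : ℕ) :
    φ (phiSum a n) = φ (phiSum 0 n) := by
  have h1 : ∀ b k, φ b = 0 → φ (qPoch b k) = 1 := by
    intro b k hb
    simp [qPoch, map_prod, hb]
  have h2 : ∀ b k, φ b = 0 → φ (qPoch (b * X) k)⁻¹ = 1 := by
    intro b k hb
    have h : qPoch (b * X) k * (qPoch (b * X) k)⁻¹ = 1 :=
      PowerSeries.mul_inv_cancel _ (by simp [constantCoeff_qPoch])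
    have := congrArg φ h
    rwa [map_mul, h1 _ _ (by simp [hb]), one_mul, map_one] at this
  simp only [phiSum, map_sum, phiTerm, map_mul]
  refine Finset.sum_congr rfl fun k _ => ?_
  rw [h1 a k ha, h1 0 k (map_zero φ), h2 a k ha, h2 0 k (map_zero φ)]

theorem phiSum_one (n : ℕ) : phiSum 1 (n + 1) = 1 := by
  rw [phiSum, Finset.sum_range_succ', Finset.sum_eq_zero]
  · simp [phiTerm, qPoch_zero]
  · intro i _
    simp [phiTerm, qPoch_succ' 1]

/-- A truncated form of the `q`-Kummer (Bailey–Daum) summation at `a = -1`. -/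
theorem coeff_phiSum_neg_one {n m : ℕ} (hm : n < m) {j : ℕ} (hj : j ≤ n) :
    coeff j (phiSum (-1) (n + 1) * (qPoch (-X) (2 * m) * (qPoch X (2 * m))⁻¹)) =
      coeff j ((oddPoch (-1) m * (oddPoch 1 m)⁻¹) ^ 2) := by
  let φ := Ideal.Quotient.mk (Ideal.span {(X : ℚ⟦X⟧) ^ (n + 1)})
  have hφ : φ (X ^ (n + 1)) = 0 :=
    Ideal.Quotient.eq_zero_iff_mem.mpr (Ideal.mem_span_singleton_self _)
  have hX : ∀ a, φ (a * X ^ (4 * m)) = 0 := by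
    intro a
    have : a * X ^ (4 * m) = X ^ (n + 1) * (a * X ^ (4 * m - (n + 1))) := by
      rw [mul_left_comm, ← pow_add]
      congr 2
      omega
    rw [this, map_mul, hφ, zero_mul]
  have h1 := map_phiSum_iterate φ hφ 1 m
  have h2 := map_phiSum_iterate φ hφ (-1) m
  rw [phiSum_one, map_mul, map_mul, map_phiSum_eq_of_map_eq_zero φ (hX _), map_one, mul_one] at h1
  rw [map_mul, map_mul, map_phiSum_eq_of_map_eq_zero φ (hX _)] at h2
  rw [one_mul] at h1
  rw [neg_one_mul] at h2
  have i1 : φ (qPoch X (2 * m)) * φ (qPoch X (2 * m))⁻¹ = 1 := by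
    rw [← map_mul, PowerSeries.mul_inv_cancel _ (by simp [constantCoeff_qPoch]), map_one]
  have i2 : φ (oddPoch 1 m) * φ (oddPoch 1 m)⁻¹ = 1 := by
    rw [← map_mul, PowerSeries.mul_inv_cancel _ (by simp [oddPoch, map_prod]), map_one]
  have key : φ (phiSum (-1) (n + 1) * (qPoch (-X) (2 * m) * (qPoch X (2 * m))⁻¹)) =
      φ ((oddPoch (-1) m * (oddPoch 1 m)⁻¹) ^ 2) := by
    simp only [map_mul, map_pow] at *
    generalize φ (qPoch X (2 * m))⁻¹ = p' at *
    generalize φ (qPoch X (2 * m)) = p at *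
    generalize φ (oddPoch 1 m)⁻¹ = o' at *
    generalize φ (oddPoch 1 m) = o at *
    generalize φ (phiSum 0 (n + 1)) = s at *
    have i2' : (o * o') ^ 2 = 1 := by rw [i2, one_pow]
    have hs : s = p * o' ^ 2 := by
      rw [h1]; linear_combination (-s) * i2'
    rw [hs] at h2
    linear_combination p' * h2 + φ (oddPoch (-1) m) ^ 2 * o' ^ 2 * i1
  rw [Ideal.Quotient.eq, Ideal.mem_span_singleton, X_pow_dvd_iff] at key
  have := key j (by omega)
  rwa [map_sub, sub_eq_zero] at this

/-- Nonnegative coefficients, vanishing in odd degree, with positive constant term. -/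
def EvenNonneg (f : ℚ⟦X⟧) : Prop :=
  0 < coeff 0 f ∧ ∀ j, 0 ≤ coeff j f ∧ (Odd j → coeff j f = 0)

theorem EvenNonneg.mul {f g : ℚ⟦X⟧} (hf : EvenNonneg f) (hg : EvenNonneg g) :
    EvenNonneg (f * g) := by
  refine ⟨by simpa using mul_pos hf.1 hg.1, fun j => ⟨?_, fun hj => ?_⟩⟩
  · rw [coeff_mul]
    exact Finset.sum_nonneg fun p _ => mul_nonneg (hf.2 _).1 (hg.2 _).1
  · rw [coeff_mul]
    refine Finset.sum_eq_zero fun p hp => ?_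
    rw [Finset.HasAntidiagonal.mem_antidiagonal] at hp
    rcases Nat.even_or_odd p.1 with h | h
    · rw [(hg.2 p.2).2 (by grind), mul_zero]
    · rw [(hf.2 p.1).2 h, zero_mul]

theorem EvenNonneg.one : EvenNonneg 1 := by
  refine ⟨by simp, fun j => ⟨?_, fun hj => ?_⟩⟩ <;> rw [coeff_one]
  · positivity
  · rw [if_neg]; rintro rfl; simp at hj

theorem coeff_mul_pos {f g : ℚ⟦X⟧} (hf : EvenNonneg f) (hg : EvenNonneg g)
    (hpos : ∀ j, Even j → 0 < coeff j f) {j : ℕ} (hj : Even j) : 0 < coeff j (f * g) := by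
  rw [coeff_mul]
  refine lt_of_lt_of_le (mul_pos (hpos j hj) hg.1) ?_
  exact Finset.single_le_sum (f := fun p : ℕ × ℕ => coeff p.1 f * coeff p.2 g)
    (fun p _ => mul_nonneg (hf.2 _).1 (hg.2 _).1) (a := (j, 0)) (by simp)

theorem coeff_inv_one_sub_X_pow {k : ℕ} (hk : 0 < k) (j : ℕ) :
    coeff j (1 - X ^ k : ℚ⟦X⟧)⁻¹ = if k ∣ j then 1 else 0 := by
  have hu : (1 - X ^ k : ℚ⟦X⟧)⁻¹ = 1 + X ^ k * (1 - X ^ k : ℚ⟦X⟧)⁻¹ := by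
    have := PowerSeries.mul_inv_cancel (1 - X ^ k : ℚ⟦X⟧) (by simp [hk.ne'])
    linear_combination this
  induction j using Nat.strong_induction_on with
  | _ j ih =>
    rw [hu, map_add, coeff_one, coeff_X_pow_mul']
    by_cases hkj : k ≤ j
    · rw [if_pos hkj, ih _ (by omega), if_neg (by omega), zero_add]
      simp [Nat.dvd_sub_iff_left hkj (dvd_refl k)]
    · rw [if_neg hkj, add_zero]
      congr 1
      refine propext ⟨fun h => by simp [h], fun h => ?_⟩
      by_contra h0
      exact hkj (Nat.le_of_dvd (Nat.pos_of_ne_zero h0) h)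

theorem EvenNonneg.one_add_mul_inv {k : ℕ} (hk : 0 < k) (hk2 : Even k) :
    EvenNonneg ((1 + X ^ k) * (1 - X ^ k)⁻¹) := by
  apply EvenNonneg.mul
  · refine ⟨by simp [hk.ne'], fun j => ⟨?_, fun hj => ?_⟩⟩ <;>
      rw [map_add, coeff_one, coeff_X_pow]
    · positivity
    · rw [if_neg, if_neg, add_zero]
      · rintro rfl; grind
      · rintro rfl; grind
  · refine ⟨by rw [coeff_inv_one_sub_X_pow hk]; simp, fun j => ⟨?_, fun hj => ?_⟩⟩ <;>
      rw [coeff_inv_one_sub_X_pow hk]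
    · positivity
    · rw [if_neg]
      intro h
      have := hk2.trans_dvd h
      grind

theorem coeff_one_add_mul_inv_pos {j : ℕ} (hj : Even j) :
    0 < coeff j ((1 + X ^ 2) * (1 - X ^ 2)⁻¹ : ℚ⟦X⟧) := by
  rw [add_mul, one_mul, map_add, coeff_X_pow_mul', coeff_inv_one_sub_X_pow two_pos,
    if_pos hj.two_dvd]
  split_ifs
  · rw [coeff_inv_one_sub_X_pow two_pos]; positivity
  · positivity

theorem inv_prod (s : Finset ℕ) (f : ℕ → ℚ⟦X⟧) : (∏ i ∈ s, f i)⁻¹ = ∏ i ∈ s, (f i)⁻¹ := by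
  induction s using Finset.induction_on with
  | empty => simp
  | insert a s ha ih => rw [Finset.prod_insert ha, Finset.prod_insert ha,
      PowerSeries.mul_inv_rev, ih, mul_comm]

theorem oddPoch_div (m : ℕ) : oddPoch (-1) m * (oddPoch 1 m)⁻¹ =
    ∏ i ∈ Finset.range m, ((1 + X ^ (4 * i + 2)) * (1 - X ^ (4 * i + 2))⁻¹) := by
  rw [oddPoch, oddPoch, inv_prod, ← Finset.prod_mul_distrib]
  simp

theorem EvenNonneg.prod {s : Finset ℕ} {f : ℕ → ℚ⟦X⟧} (h : ∀ i ∈ s, EvenNonneg (f i)) :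
    EvenNonneg (∏ i ∈ s, f i) :=
  Finset.prod_induction _ EvenNonneg (fun _ _ => EvenNonneg.mul) EvenNonneg.one h

theorem evenNonneg_oddPoch_sq (m : ℕ) :
    EvenNonneg ((oddPoch (-1) m * (oddPoch 1 m)⁻¹) ^ 2) := by
  have h : EvenNonneg (oddPoch (-1) m * (oddPoch 1 m)⁻¹) := by
    rw [oddPoch_div]
    exact EvenNonneg.prod fun i _ => EvenNonneg.one_add_mul_inv (by omega) (by grind)
  rw [sq]
  exact h.mul h

theorem coeff_oddPoch_sq_pos {m : ℕ} (hm : 0 < m) {j : ℕ} (hj : Even j) :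
    0 < coeff j ((oddPoch (-1) m * (oddPoch 1 m)⁻¹) ^ 2) := by
  obtain ⟨m, rfl⟩ := Nat.exists_eq_succ_of_ne_zero hm.ne'
  have h : ∀ s : Finset ℕ,
      EvenNonneg (∏ i ∈ s, ((1 + X ^ (4 * (i + 1) + 2)) * (1 - X ^ (4 * (i + 1) + 2))⁻¹)) :=
    fun s => EvenNonneg.prod fun i _ => EvenNonneg.one_add_mul_inv (by omega) (by grind)
  have h0 : EvenNonneg ((1 + X ^ 2) * (1 - X ^ 2)⁻¹) :=
    EvenNonneg.one_add_mul_inv two_pos even_two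
  rw [oddPoch_div, Finset.prod_range_succ', sq, mul_zero, zero_add, mul_comm (∏ i ∈ _, _),
    mul_assoc]
  exact coeff_mul_pos h0 ((h _).mul (h0.mul (h _))) (fun _ => coeff_one_add_mul_inv_pos) hj

open scoped PowerSeries.WithPiTopology in
theorem genFun_eq_prod {w : ℕ → ℚ} {B : ℕ} (hw : ∀ i, B < i → w i = 0) :
    Nat.Partition.genFun (fun i _ => w i) =
      ∏ i ∈ Finset.range B, (1 + w (i + 1) • (X ^ (i + 1) * (1 - X ^ (i + 1))⁻¹)) := by
  have h := Nat.Partition.hasProd_genFun (fun i _ => w i)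
  have hterm : ∀ i : ℕ, (1 : ℚ⟦X⟧) + ∑' j, w (i + 1) • X ^ ((i + 1) * (j + 1)) =
      1 + w (i + 1) • (X ^ (i + 1) * (1 - X ^ (i + 1))⁻¹) := by
    intro i
    have hs : constantCoeff (X ^ (i + 1) : ℚ⟦X⟧) = 0 := by simp
    have hsum := PowerSeries.WithPiTopology.summable_pow_of_constantCoeff_eq_zero hs
    have hg : ∑' j : ℕ, (X ^ (i + 1) : ℚ⟦X⟧) ^ j = (1 - X ^ (i + 1))⁻¹ := by
      rw [PowerSeries.eq_inv_iff_mul_eq_one (by simp)]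
      exact PowerSeries.WithPiTopology.tsum_pow_mul_one_sub_of_constantCoeff_eq_zero hs
    rw [← hg, ← hsum.tsum_mul_left, smul_eq_C_mul, ← (hsum.mul_left _).tsum_mul_left]
    congr 2
    ext1 j
    rw [smul_eq_C_mul, pow_mul, pow_succ' _ j]
  simp only [hterm] at h
  refine h.unique (hasProd_prod_of_ne_finset_one fun i hi => ?_)
  rw [hw _ (by simpa using hi)]
  simp

theorem prod_range_two_mul (f : ℕ → ℚ⟦X⟧) (n : ℕ) : ∏ i ∈ Finset.range (2 * n), f i =
    (∏ i ∈ Finset.range n, f (2 * i)) * ∏ i ∈ Finset.range n, f (2 * i + 1) := by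
  induction n with
  | zero => simp
  | succ n ih =>
    rw [show 2 * (n + 1) = 2 * n + 1 + 1 by ring]
    simp only [Finset.prod_range_succ, ih]
    ring

/-- The number of ways to overline a part `i` (apart from the largest even part `2N`), truncated
to odd parts below `2L`. -/
def partWeight (L N i : ℕ) : ℚ :=
  if Even i then (if i < 2 * N then 2 else if i = 2 * N then 1 else 0)
  else if 2 * N < i ∧ i < 2 * L then 2 else 0

/-- The number of ways to overline the largest even part `2N`. -/
def lepWeight (N : ℕ) : ℚ := if N = 0 then 1 else 2

theorem qPoch_mul_inv {a : ℚ⟦X⟧} (ha : constantCoeff a = 0) (n : ℕ) :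
    qPoch a n * (qPoch a n)⁻¹ = 1 :=
  PowerSeries.mul_inv_cancel _ (by simp [constantCoeff_qPoch ha])

theorem one_add_two_smul {k : ℕ} (hk : k ≠ 0) :
    1 + (2 : ℚ) • (X ^ k * (1 - X ^ k : ℚ⟦X⟧)⁻¹) = (1 + X ^ k) * (1 - X ^ k)⁻¹ := by
  have := PowerSeries.mul_inv_cancel (1 - X ^ k : ℚ⟦X⟧) (by simp [hk])
  rw [two_smul]
  linear_combination -this

theorem one_add_one_smul {k : ℕ} (hk : k ≠ 0) :
    1 + (1 : ℚ) • (X ^ k * (1 - X ^ k : ℚ⟦X⟧)⁻¹) = (1 - X ^ k)⁻¹ := by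
  have := PowerSeries.mul_inv_cancel (1 - X ^ k : ℚ⟦X⟧) (by simp [hk])
  rw [one_smul]
  linear_combination -this

theorem prod_odd_parts {L N : ℕ} (h : N ≤ L) :
    ∏ j ∈ Finset.range L, (if N ≤ j then
      ((1 + X ^ (2 * j + 1)) * (1 - X ^ (2 * j + 1))⁻¹ : ℚ⟦X⟧) else 1) =
    qPoch (-X) L * (qPoch X L)⁻¹ * (qPoch X N * (qPoch (-X) N)⁻¹) := by
  induction L, h using Nat.le_induction with
  | base =>
    rw [Finset.prod_congr rfl fun j hj => if_neg (by simpa using hj)]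
    have h1 := qPoch_mul_inv (a := X) (by simp) N
    have h2 := qPoch_mul_inv (a := -X) (by simp) N
    rw [Finset.prod_const_one]
    linear_combination -h1 - qPoch X N * (qPoch X N)⁻¹ * h2
  | succ L h ih =>
    rw [Finset.prod_range_succ, ih, if_pos h, qPoch_succ, qPoch_succ, PowerSeries.mul_inv_rev]
    rw [show X * X ^ (2 * L) = (X : ℚ⟦X⟧) ^ (2 * L + 1) by ring]
    ring

theorem prod_even_parts {L N : ℕ} (h : N ≤ L) :
    C (lepWeight N) * ∏ j ∈ Finset.range L, (if j + 1 < N then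
      ((1 + X ^ (2 * j + 2)) * (1 - X ^ (2 * j + 2))⁻¹ : ℚ⟦X⟧) else
        if j + 1 = N then (1 - X ^ (2 * j + 2))⁻¹ else 1) =
    qPoch (-1) N * (qPoch (X ^ 2) N)⁻¹ := by
  induction L, h using Nat.le_induction with
  | base =>
    cases N with
    | zero => simp [lepWeight, qPoch_zero]
    | succ M =>
      have hM : ∏ j ∈ Finset.range M, (if j + 1 < M + 1 then
          ((1 + X ^ (2 * j + 2)) * (1 - X ^ (2 * j + 2))⁻¹ : ℚ⟦X⟧) else
            if j + 1 = M + 1 then (1 - X ^ (2 * j + 2))⁻¹ else 1) =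
          qPoch (-X ^ 2) M * (qPoch (X ^ 2) M)⁻¹ := by
        rw [qPoch, qPoch, inv_prod, ← Finset.prod_mul_distrib]
        refine Finset.prod_congr rfl fun j hj => ?_
        rw [if_pos (by simpa using hj)]
        ring_nf
      rw [Finset.prod_range_succ, hM, qPoch_succ', qPoch_succ, PowerSeries.mul_inv_rev, if_neg
        (by omega), if_pos rfl, lepWeight, if_neg (by omega), neg_one_mul,
        show X ^ 2 * X ^ (2 * M) = (X : ℚ⟦X⟧) ^ (2 * M + 2) by ring]
      have : (C (2 : ℚ) : ℚ⟦X⟧) = 1 - -1 := by rw [map_ofNat]; norm_num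
      rw [this]
      ring
  | succ L h ih =>
    rw [Finset.prod_range_succ, ← mul_assoc, ih, if_neg (by omega), if_neg (by omega), mul_one]

theorem lepWeight_mul_genFun {L N : ℕ} (h : N ≤ L) :
    (-X) ^ N * C (lepWeight N) * Nat.Partition.genFun (fun i _ => partWeight L N i) =
      phiTerm (-1) N * (qPoch (-X) L * (qPoch X L)⁻¹) := by
  have hw : ∀ i, 2 * L < i → partWeight L N i = 0 := by
    intro i hi
    unfold partWeight
    split_ifs <;> first | rfl | omega
  rw [genFun_eq_prod hw, prod_range_two_mul, phiTerm, neg_one_mul]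
  have ho : ∏ j ∈ Finset.range L, (1 + partWeight L N (2 * j + 1) •
      (X ^ (2 * j + 1) * (1 - X ^ (2 * j + 1))⁻¹)) =
      qPoch (-X) L * (qPoch X L)⁻¹ * (qPoch X N * (qPoch (-X) N)⁻¹) := by
    rw [← prod_odd_parts h]
    refine Finset.prod_congr rfl fun j hj => ?_
    rw [Finset.mem_range] at hj
    rw [partWeight, if_neg (by simp)]
    split_ifs
    · exact one_add_two_smul (by omega)
    · omega
    · omega
    · simp
  have he : C (lepWeight N) * ∏ j ∈ Finset.range L, (1 + partWeight L N (2 * j + 1 + 1) •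
      (X ^ (2 * j + 1 + 1) * (1 - X ^ (2 * j + 1 + 1))⁻¹)) =
      qPoch (-1) N * (qPoch (X ^ 2) N)⁻¹ := by
    rw [← prod_even_parts h]
    congr 1
    refine Finset.prod_congr rfl fun j hj => ?_
    rw [partWeight, if_pos (by grind)]
    split_ifs <;> first
      | omega
      | exact one_add_two_smul (by omega)
      | exact one_add_one_smul (by omega)
      | simp
  rw [ho]
  linear_combination (-X) ^ N * (qPoch (-X) L * (qPoch X L)⁻¹ * (qPoch X N * (qPoch (-X) N)⁻¹)) * he

/-- The weighted count of partitions underlying members of `EO̅*` with largest even part `2N`. -/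
noncomputable def weightedCount (L N k : ℕ) : ℚ :=
  lepWeight N * coeff k (Nat.Partition.genFun (fun i _ => partWeight L N i))

theorem sum_weightedCount {s m : ℕ} (hm : s < m) :
    ∑ N ∈ Finset.range (s + 1), (-1) ^ N * weightedCount (2 * m) N (s - N) =
      coeff s ((oddPoch (-1) m * (oddPoch 1 m)⁻¹) ^ 2) := by
  rw [← coeff_phiSum_neg_one hm le_rfl, phiSum, Finset.sum_mul, map_sum]
  refine Finset.sum_congr rfl fun N hN => ?_
  rw [Finset.mem_range] at hN
  rw [← lepWeight_mul_genFun (by omega), weightedCount, neg_pow X,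
    show (-1 : ℚ⟦X⟧) ^ N = C ((-1) ^ N) by simp, mul_assoc, mul_assoc, coeff_C_mul,
    coeff_X_pow_mul', if_pos (by omega), coeff_C_mul]

theorem le_lep {m : Multiset ℕ} {x : ℕ} (hx : x ∈ m) (he : Even x) : x ≤ lep m :=
  Multiset.le_sup (Multiset.mem_filter.mpr ⟨hx, he⟩)

theorem sup_mem_of_ne_zero {m : Multiset ℕ} (h : m.sup ≠ 0) : m.sup ∈ m := by
  induction m using Multiset.induction_on with
  | empty => simp at h
  | cons a s ih =>
    rw [Multiset.sup_cons] at h ⊢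
    rcases le_total a s.sup with h1 | h1
    · rw [sup_eq_right.mpr h1] at h ⊢
      exact Multiset.mem_cons_of_mem (ih h)
    · rw [sup_eq_left.mpr h1]
      exact Multiset.mem_cons_self a s

theorem lep_mem {m : Multiset ℕ} (h : lep m ≠ 0) : lep m ∈ m :=
  (Multiset.mem_filter.mp (sup_mem_of_ne_zero h)).1

theorem even_lep (m : Multiset ℕ) : Even (lep m) := by
  by_cases h : lep m = 0
  · simp [h]
  · exact (Multiset.mem_filter.mp (sup_mem_of_ne_zero h)).2

theorem lep_le_sum (m : Multiset ℕ) : lep m ≤ m.sum := by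
  by_cases h : lep m = 0
  · simp [h]
  · exact Multiset.single_le_sum (by simp) _ (lep_mem h)

theorem exists_eq_add_self {m : Multiset ℕ} (h : ∀ x, Even (m.count x)) : ∃ l, m = l + l := by
  refine ⟨Finsupp.toMultiset (m.toFinsupp.mapRange (· / 2) rfl), ?_⟩
  ext x
  have := h x
  simp only [Multiset.count_add, Finsupp.count_toMultiset, Finsupp.mapRange_apply,
    Multiset.toFinsupp_apply]
  grind

/-- The multiset consisting of the part `2N`, omitted when it is zero. -/
def lepPart (N : ℕ) : Multiset ℕ := if N = 0 then 0 else {2 * N}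

/-- All parts are positive, with even parts at most `2N` and odd parts above `2N`. -/
def Allowed (N : ℕ) (l : Multiset ℕ) : Prop :=
  ∀ i ∈ l, 0 < i ∧ ((Even i ∧ i ≤ 2 * N) ∨ (Odd i ∧ 2 * N < i))

theorem count_lepPart (N x : ℕ) : (lepPart N).count x = if N ≠ 0 ∧ x = 2 * N then 1 else 0 := by
  unfold lepPart
  split_ifs <;> simp_all

theorem mem_lepPart {N x : ℕ} : x ∈ lepPart N ↔ N ≠ 0 ∧ x = 2 * N := by
  unfold lepPart
  split_ifs <;> simp_all

theorem sum_lepPart (N : ℕ) : (lepPart N).sum = 2 * N := by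
  unfold lepPart
  split_ifs <;> simp_all

theorem lep_lepPart_add {N : ℕ} {l : Multiset ℕ} (hl : Allowed N l) :
    lep (lepPart N + (l + l)) = 2 * N := by
  apply le_antisymm
  · refine Multiset.sup_le.mpr fun x hx => ?_
    simp only [Multiset.mem_filter, Multiset.mem_add, mem_lepPart, or_self] at hx
    rcases hx.1 with h | h
    · exact h.2.le
    · have := hl x h
      grind
  · rcases Nat.eq_zero_or_pos N with h | h
    · simp [h]
    · exact le_lep (by simp [mem_lepPart, h.ne']) (by simp)

theorem overEOStar_iff {p : Multiset ℕ × Finset ℕ} {N : ℕ} :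
    (OverEOStar p ∧ lep p.1 = 2 * N) ↔
      ∃ l, Allowed N l ∧ p.1 = lepPart N + (l + l) ∧ p.2 ⊆ p.1.toFinset := by
  obtain ⟨m, t⟩ := p
  constructor
  · rintro ⟨⟨⟨hpos, ht⟩, hlt, heven, hodd⟩, hlep⟩
    simp only at hpos ht hlt heven hodd hlep ⊢
    have hmem : N ≠ 0 → 2 * N ∈ m := fun h => hlep ▸ lep_mem (by omega)
    have hle : lepPart N ≤ m := by
      rw [Multiset.le_iff_count]
      intro x
      rw [count_lepPart]
      split_ifs with h
      · exact Multiset.one_le_count_iff_mem.mpr (h.2 ▸ hmem h.1)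
      · exact Nat.zero_le _
    obtain ⟨r, rfl⟩ := Multiset.le_iff_exists_add.mp hle
    obtain ⟨l, rfl⟩ : ∃ l, r = l + l := by
      refine exists_eq_add_self fun x => ?_
      by_cases hx : x ∈ lepPart N + r
      · have h0 := hpos x hx
        have h1 := heven x hx
        have h2 := hodd x hx
        rw [hlep, Multiset.count_add, count_lepPart] at h1 h2
        split_ifs at h1 h2 <;> grind
      · rw [Multiset.count_eq_zero_of_notMem fun h => hx (by simp [h])]
        exact Even.zero
    refine ⟨l, fun i hi => ?_, rfl, ht⟩
    have him : i ∈ lepPart N + (l + l) := by simp [hi]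
    refine ⟨hpos i him, ?_⟩
    rcases Nat.even_or_odd i with h | h
    · exact Or.inl ⟨h, hlep ▸ le_lep him h⟩
    · refine Or.inr ⟨h, ?_⟩
      by_cases hN : N = 0
      · have := hpos i him
        omega
      · exact hlt _ (hmem hN) _ him (by simp) h
  · rintro ⟨l, hl, hm, ht⟩
    simp only at hm ht ⊢
    subst hm
    have hlep := lep_lepPart_add hl
    have hmem : ∀ x ∈ lepPart N + (l + l), (N ≠ 0 ∧ x = 2 * N) ∨ x ∈ l := by
      intro x hx
      simpa [mem_lepPart] using hx
    refine ⟨⟨⟨fun x hx => ?_, ht⟩, fun x hx y hy hx2 hy2 => ?_, fun x hx hne => ?_,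
      fun x hx heq => ?_⟩, hlep⟩
    · rcases hmem x hx with h | h
      · omega
      · exact (hl x h).1
    · have h1 : x ≤ 2 * N := hlep ▸ le_lep hx hx2
      rcases hmem y hy with h | h
      · grind
      · have := hl y h
        grind
    · simp only at hne ⊢
      rw [hlep] at hne
      simp [count_lepPart, hne]
    · simp only at heq ⊢
      rw [hlep] at heq
      have hN : N ≠ 0 := by
        rintro rfl
        rcases hmem x hx with h | h
        · exact h.1 rfl
        · have := (hl x h).1
          omega
      rw [Multiset.count_add, Multiset.count_add, count_lepPart, if_pos ⟨hN, heq⟩]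
      grind

/-- Members of `EO̅*` of size `n` with largest even part `k`. -/
def overEOSet (n k : ℕ) : Set (Multiset ℕ × Finset ℕ) :=
  {p | OverEOStar p ∧ p.1.sum = n ∧ lep p.1 = k}

theorem even_sum_of_overEOStar {p : Multiset ℕ × Finset ℕ} (hp : OverEOStar p) : Even p.1.sum := by
  obtain ⟨N, hN⟩ := even_lep p.1
  obtain ⟨l, -, h, -⟩ := overEOStar_iff.mp ⟨hp, by rw [hN, two_mul]⟩
  rw [h, Multiset.sum_add, sum_lepPart, Multiset.sum_add]
  grind

open Classical in
/-- The members of `EO̅*` with largest even part `2N` built from the partitions of `k`. -/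
noncomputable def overEOFinset (N k : ℕ) : Finset (Multiset ℕ × Finset ℕ) :=
  ((Finset.univ : Finset k.Partition).filter (fun l => Allowed N l.parts)).biUnion fun l =>
    (lepPart N + (l.parts + l.parts)).toFinset.powerset.image
      fun t => (lepPart N + (l.parts + l.parts), t)

theorem coe_overEOFinset {s N : ℕ} (h : N ≤ s) :
    (overEOFinset N (s - N) : Set (Multiset ℕ × Finset ℕ)) = overEOSet (2 * s) (2 * N) := by
  ext ⟨m, t⟩
  have : (m, t) ∈ overEOSet (2 * s) (2 * N) ↔
      (OverEOStar (m, t) ∧ lep (m, t).1 = 2 * N) ∧ m.sum = 2 * s := by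
    simp only [overEOSet, Set.mem_ofPred_eq]
    tauto
  rw [this, overEOStar_iff]
  simp only [overEOFinset, Finset.coe_biUnion, Finset.coe_image, Set.mem_iUnion, Set.mem_image,
    Finset.mem_coe, Finset.mem_filter, Finset.mem_univ, true_and, Finset.mem_powerset,
    Prod.mk.injEq, exists_prop]
  constructor
  · rintro ⟨l, hl, t', ht', rfl, rfl⟩
    refine ⟨⟨l.parts, hl, rfl, ht'⟩, ?_⟩
    rw [Multiset.sum_add, Multiset.sum_add, sum_lepPart, l.parts_sum]
    omega
  · rintro ⟨⟨l, hl, rfl, ht⟩, hs⟩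
    rw [Multiset.sum_add, Multiset.sum_add, sum_lepPart] at hs
    exact ⟨⟨l, fun {i} hi => (hl i hi).1, by omega⟩, hl, t, ht, rfl, rfl⟩

theorem card_overEOFinset (N k : ℕ) : (overEOFinset N k).card =
    ∑ l : k.Partition, open Classical in if Allowed N l.parts then
      2 ^ (lepPart N + (l.parts + l.parts)).toFinset.card else 0 := by
  classical
  rw [overEOFinset, Finset.card_biUnion, Finset.sum_filter]
  · refine Finset.sum_congr rfl fun l _ => ?_
    rw [Finset.card_image_of_injective _ (Prod.mk_right_injective _), Finset.card_powerset]
  · intro l _ l' _ hne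
    rw [Function.onFun, Finset.disjoint_left]
    simp only [Finset.mem_image, not_exists, not_and]
    rintro _ ⟨t, -, rfl⟩ t' - h
    apply hne
    have h1 := add_left_cancel (Prod.ext_iff.mp h).1
    refine Nat.Partition.ext ?_
    ext x
    have := congrArg (Multiset.count x) h1
    simp only [Multiset.count_add] at this
    omega

theorem ncard_eq_sum_card_overEOFinset (n r : ℕ) (hr : r < 2) :
    {p : Multiset ℕ × Finset ℕ | OverEOStar p ∧ p.1.sum = 2 * n ∧ lep p.1 % 4 = 2 * r}.ncard =
      ∑ N ∈ (Finset.range (n + 1)).filter (· % 2 = r), (overEOFinset N (n - N)).card := by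
  classical
  have : {p : Multiset ℕ × Finset ℕ | OverEOStar p ∧ p.1.sum = 2 * n ∧ lep p.1 % 4 = 2 * r} =
      (((Finset.range (n + 1)).filter (· % 2 = r)).biUnion fun N => overEOFinset N (n - N) :
        Finset _) := by
    ext p
    simp only [Finset.coe_biUnion, Set.mem_iUnion, Finset.coe_filter, Finset.mem_range,
      Set.mem_ofPred_eq, exists_prop]
    constructor
    · rintro ⟨hp, hs, hl⟩
      obtain ⟨N, hN⟩ := even_lep p.1
      have := lep_le_sum p.1
      refine ⟨N, ⟨by omega, by omega⟩, ?_⟩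
      rw [coe_overEOFinset (by omega)]
      exact ⟨hp, hs, by omega⟩
    · rintro ⟨N, ⟨hN, hNr⟩, hp⟩
      rw [coe_overEOFinset (by omega)] at hp
      obtain ⟨h1, h2, h3⟩ := hp
      exact ⟨h1, h2, by omega⟩
  rw [this, Set.ncard_coe_finset, Finset.card_biUnion]
  intro N hN N' hN' hne
  simp only [Finset.coe_filter, Finset.mem_range, Set.mem_ofPred_eq] at hN hN'
  rw [Function.onFun, ← Finset.disjoint_coe, coe_overEOFinset (by omega), coe_overEOFinset (by omega),
    Set.disjoint_left]
  rintro p ⟨-, -, h1⟩ ⟨-, -, h2⟩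
  omega

theorem partWeight_of_allowed {L N i : ℕ} (hi : i < 2 * L)
    (h : (Even i ∧ i ≤ 2 * N) ∨ (Odd i ∧ 2 * N < i)) :
    partWeight L N i = if i = 2 * N then 1 else 2 := by
  unfold partWeight
  split_ifs <;> grind

theorem toFinset_lepPart_add (N : ℕ) (l : Multiset ℕ) :
    (lepPart N + (l + l)).toFinset = if N = 0 then l.toFinset else insert (2 * N) l.toFinset := by
  ext x
  split_ifs <;> simp_all [mem_lepPart]

theorem two_pow_card_eq {L N k : ℕ} (hk : k < 2 * L) (l : k.Partition)
    (hl : Allowed N l.parts) :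
    (2 : ℚ) ^ (lepPart N + (l.parts + l.parts)).toFinset.card =
      lepWeight N * l.parts.toFinsupp.prod fun i _ => partWeight L N i := by
  have hprod : (l.parts.toFinsupp.prod fun i _ => partWeight L N i) =
      2 ^ (l.parts.toFinset.erase (2 * N)).card := by
    rw [Finsupp.prod, Multiset.toFinsupp_support, Finset.prod_congr rfl fun i hi =>
      partWeight_of_allowed ((l.le_of_mem_parts (Multiset.mem_toFinset.mp hi)).trans_lt hk)
        (hl i (Multiset.mem_toFinset.mp hi)).2, Finset.prod_ite, Finset.prod_const_one, one_mul,
      Finset.prod_const, Finset.filter_ne']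
  rw [hprod, toFinset_lepPart_add, lepWeight]
  split_ifs with h
  · rw [Finset.erase_eq_of_notMem, one_mul]
    intro h0
    have := l.parts_pos (Multiset.mem_toFinset.mp h0)
    omega
  · have : insert (2 * N) l.parts.toFinset = insert (2 * N) (l.parts.toFinset.erase (2 * N)) := by
      ext x
      simp only [Finset.mem_insert, Finset.mem_erase]
      tauto
    rw [this, Finset.card_insert_of_notMem (Finset.notMem_erase _ _), pow_succ']

theorem prod_partWeight_eq_zero {L N k : ℕ} (l : k.Partition) (hl : ¬ Allowed N l.parts) :
    (l.parts.toFinsupp.prod fun i _ => partWeight L N i) = 0 := by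
  simp only [Allowed, not_forall] at hl
  obtain ⟨i, hi, h⟩ := hl
  refine Finset.prod_eq_zero (i := i) (by simpa using hi) ?_
  have := l.parts_pos hi
  simp only [partWeight]
  split_ifs <;> grind

theorem cast_card_overEOFinset {L N k : ℕ} (hk : k < 2 * L) :
    ((overEOFinset N k).card : ℚ) = weightedCount L N k := by
  classical
  rw [card_overEOFinset, weightedCount, Nat.Partition.coeff_genFun, Finset.mul_sum, Nat.cast_sum]
  refine Finset.sum_congr rfl fun l _ => ?_
  split_ifs with h
  · rw [← two_pow_card_eq hk l h]
    norm_cast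
  · rw [prod_partWeight_eq_zero l h, mul_zero, Nat.cast_zero]

theorem ncard_sub_ncard (s : ℕ) :
    ({p : Multiset ℕ × Finset ℕ | OverEOStar p ∧ p.1.sum = 2 * s ∧ lep p.1 % 4 = 0}.ncard : ℚ) -
      {p : Multiset ℕ × Finset ℕ | OverEOStar p ∧ p.1.sum = 2 * s ∧ lep p.1 % 4 = 2}.ncard =
      coeff s ((oddPoch (-1) (s + 1) * (oddPoch 1 (s + 1))⁻¹) ^ 2) := by
  have h0 := ncard_eq_sum_card_overEOFinset s 0 two_pos
  have h1 := ncard_eq_sum_card_overEOFinset s 1 one_lt_two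
  rw [mul_zero] at h0
  rw [mul_one] at h1
  rw [h0, h1, ← sum_weightedCount s.lt_succ_self, Finset.sum_filter, Finset.sum_filter,
    Nat.cast_sum, Nat.cast_sum, ← Finset.sum_sub_distrib]
  refine Finset.sum_congr rfl fun N _ => ?_
  rw [← cast_card_overEOFinset (by omega)]
  rcases Nat.even_or_odd N with h | h
  · rw [if_pos (Nat.even_iff.mp h), if_neg (by grind), h.neg_one_pow]
    simp
  · rw [if_neg (by grind), if_pos (Nat.odd_iff.mp h), h.neg_one_pow]
    simp

end OverpartitionEO

/-- Theorem 2 (overpartitions): `eo̅₀(n) = eo̅₂(n)` if `4 ∤ n`, and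
`eo̅₀(n) > eo̅₂(n)` if `4 ∣ n`. -/
theorem stmt12 (n : ℕ) (hn : 0 < n) :
    (¬ (4 ∣ n) →
      {p : Multiset ℕ × Finset ℕ | OverEOStar p ∧ p.1.sum = n ∧ lep p.1 % 4 = 0}.ncard =
      {p : Multiset ℕ × Finset ℕ | OverEOStar p ∧ p.1.sum = n ∧ lep p.1 % 4 = 2}.ncard) ∧
    ((4 ∣ n) →
      {p : Multiset ℕ × Finset ℕ | OverEOStar p ∧ p.1.sum = n ∧ lep p.1 % 4 = 2}.ncard <
      {p : Multiset ℕ × Finset ℕ | OverEOStar p ∧ p.1.sum = n ∧ lep p.1 % 4 = 0}.ncard) := by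
  open OverpartitionEO in
  rcases Nat.even_or_odd' n with ⟨s, rfl | rfl⟩
  · have h := ncard_sub_ncard s
    constructor
    · intro h4
      have hs : Odd s := by
        rw [← Nat.not_even_iff_odd]
        rintro ⟨k, rfl⟩
        exact h4 ⟨k, by ring⟩
      rw [((evenNonneg_oddPoch_sq _).2 s).2 hs, sub_eq_zero] at h
      exact_mod_cast h
    · intro h4
      have hs : Even s := by
        obtain ⟨k, hk⟩ := h4
        exact ⟨k, by omega⟩
      have := coeff_oddPoch_sq_pos s.succ_pos hs
      rw [← h, sub_pos] at this
      exact_mod_cast this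
  · have hempty : ∀ r, {p : Multiset ℕ × Finset ℕ |
        OverEOStar p ∧ p.1.sum = 2 * s + 1 ∧ lep p.1 % 4 = r} = ∅ := by
      refine fun r => Set.eq_empty_of_forall_notMem fun p ⟨hp, hs, _⟩ => ?_
      have := even_sum_of_overEOStar hp
      rw [hs] at this
      grind
    refine ⟨fun _ => by rw [hempty, hempty], fun h => ?_⟩
    omega
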